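/- arXiv:2007.13391 — 5 statements merged into one kernel-verified Lean document; each statement's English description precedes it below -/
import Mathlib

section
/- Decay of the weighted L¹ norm: assume S(t) is positivity-preserving and that φ_1 ≥ 0 μ-a.e. Let w : Ω → [0,∞) be measurable and let c, C > 0 satisfy c·w ≤ φ_1 ≤ C·w μ-a.e. Then for every u₀ ∈ L²(Ω,μ) and every t ≥ 0, ∫_Ω |S(t)u₀| w dμ ≤ (C/c) e^{−λ_1 t} ∫_Ω |u₀| w dμ. -/
open scoped RealInnerProductSpace
open MeasureTheory

/-- Multiplying the coefficients of a vector in a Hilbert basis by scalars bounded by `1` gives a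
summable series. -/
theorem HilbertBasis.summable_mul_inner_smul {ι E : Type*} [NormedAddCommGroup E]
    [InnerProductSpace ℝ E] (b : HilbertBasis ι ℝ E) {a : ι → ℝ} (ha : ∀ k, |a k| ≤ 1) (u : E) :
    Summable fun k => (a k * ⟪u, b k⟫) • b k := by
  have hmem : Memℓp (fun k => a k * ⟪u, b k⟫) 2 := by
    refine memℓp_gen ?_
    have hu := (lp.memℓp (b.repr u)).summable (by norm_num)
    refine hu.of_nonneg_of_le (fun k => by positivity) fun k => ?_
    rw [b.repr_apply_apply, real_inner_comm, norm_mul]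
    refine Real.rpow_le_rpow (by positivity) ?_ (by norm_num)
    exact mul_le_of_le_one_left (norm_nonneg _) (ha k)
  exact (b.hasSum_repr_symm ⟨_, hmem⟩).summable

/-- The coefficients of a diagonal operator applied to a vector. -/
theorem HilbertBasis.inner_tsum_mul_inner_smul {ι E : Type*} [NormedAddCommGroup E]
    [InnerProductSpace ℝ E] (b : HilbertBasis ι ℝ E) {a : ι → ℝ} (ha : ∀ k, |a k| ≤ 1) (u : E)
    (j : ι) : ⟪∑' k, (a k * ⟪u, b k⟫) • b k, b j⟫ = a j * ⟪u, b j⟫ := by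
  rw [real_inner_comm, ← innerSL_apply_apply ℝ (b j),
    (innerSL ℝ (b j)).map_tsum (b.summable_mul_inner_smul ha u), tsum_eq_single j]
  · rw [innerSL_apply_apply, real_inner_smul_right, real_inner_self_eq_norm_sq,
      b.orthonormal.1 j, one_pow, mul_one]
  · intro k hk
    rw [innerSL_apply_apply, real_inner_smul_right, b.orthonormal.2 hk.symm, mul_zero]

/-- A positivity-preserving additive map on `L²` satisfies `|T u| ≤ T |u|` a.e. -/
theorem MeasureTheory.Lp.ae_abs_map_le_map_abs {Ω : Type*} [MeasurableSpace Ω] {μ : Measure Ω}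
    (T : Lp ℝ 2 μ →+ Lp ℝ 2 μ)
    (hT : ∀ u : Lp ℝ 2 μ, (∀ᵐ x ∂μ, 0 ≤ u x) → ∀ᵐ x ∂μ, 0 ≤ (T u) x) (u : Lp ℝ 2 μ) :
    ∀ᵐ x ∂μ, |(T u) x| ≤ (T |u|) x := by
  have habs := Lp.coeFn_abs u
  have hsub := hT (|u| - u) (by
    filter_upwards [habs, Lp.coeFn_sub |u| u] with x h₁ h₂
    rw [h₂, Pi.sub_apply, h₁]
    exact sub_nonneg.2 (le_abs_self _))
  have hadd := hT (|u| + u) (by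
    filter_upwards [habs, Lp.coeFn_add |u| u] with x h₁ h₂
    rw [h₂, Pi.add_apply, h₁]
    linarith [neg_abs_le (u x)])
  rw [map_sub] at hsub
  rw [map_add] at hadd
  filter_upwards [hsub, hadd, Lp.coeFn_sub (T |u|) (T u), Lp.coeFn_add (T |u|) (T u)]
    with x h₁ h₂ h₃ h₄
  rw [h₃, Pi.sub_apply] at h₁
  rw [h₄, Pi.add_apply] at h₂
  exact abs_le.2 ⟨by linarith, by linarith⟩

/-- **Decay of the weighted L¹ norm.**
Assume `S t` is positivity-preserving and `φ 0 ≥ 0` a.e.  Let `w : Ω → [0, ∞)` be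
measurable and `c, C > 0` with `c • w ≤ φ 0 ≤ C • w` a.e.  Then for every
`u₀ ∈ L²(Ω, μ)` and every `t ≥ 0`,
`∫ |S t u₀| w dμ ≤ (C/c) e^{-λ₁ t} ∫ |u₀| w dμ`. -/
theorem heat_semigroup_weighted_L1_decay
    {Ω : Type*} [MeasurableSpace Ω] (μ : Measure Ω) [IsFiniteMeasure μ]
    (φ : HilbertBasis ℕ ℝ (Lp ℝ 2 μ)) (lam : ℕ → ℝ)
    (hmono : Monotone lam) (hpos : 0 < lam 0)
    (S : ℝ → Lp ℝ 2 μ → Lp ℝ 2 μ)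
    (hS : ∀ t u, S t u = ∑' k, (Real.exp (-(lam k) * t) * ⟪u, φ k⟫) • φ k)
    (hpositivity : ∀ t : ℝ, 0 ≤ t → ∀ u : Lp ℝ 2 μ,
      (∀ᵐ x ∂μ, 0 ≤ u x) → ∀ᵐ x ∂μ, 0 ≤ (S t u) x)
    (hφ1nonneg : ∀ᵐ x ∂μ, 0 ≤ (φ 0) x)
    (w : Ω → ℝ) (hw_meas : Measurable w) (hw_nonneg : ∀ x, 0 ≤ w x)
    (c C : ℝ) (hc : 0 < c) (hC : 0 < C)
    (hcw : ∀ᵐ x ∂μ, c * w x ≤ (φ 0) x) (hCw : ∀ᵐ x ∂μ, (φ 0) x ≤ C * w x)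
    (u₀ : Lp ℝ 2 μ) (t : ℝ) (ht : 0 ≤ t) :
    ∫ x, |(S t u₀) x| * w x ∂μ ≤
      (C / c) * Real.exp (-(lam 0) * t) * ∫ x, |u₀ x| * w x ∂μ := by
  have ha : ∀ k, |Real.exp (-(lam k) * t)| ≤ 1 := fun k => by
    rw [Real.abs_exp, Real.exp_le_one_iff]
    nlinarith [hmono (Nat.zero_le k)]
  have hadd : ∀ u v, S t (u + v) = S t u + S t v := fun u v => by
    simp only [hS]
    rw [← (φ.summable_mul_inner_smul ha u).tsum_add (φ.summable_mul_inner_smul ha v)]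
    simp only [inner_add_left, mul_add, add_smul]
  have hdom : ∀ᵐ x ∂μ, |(S t u₀) x| ≤ (S t |u₀|) x :=
    Lp.ae_abs_map_le_map_abs (AddMonoidHom.mk' (S t) hadd) (hpositivity t ht) u₀
  have hw : MemLp w 2 μ := by
    refine (Lp.memLp (φ 0)).of_le_mul (c := c⁻¹) hw_meas.aestronglyMeasurable ?_
    filter_upwards [hcw, hφ1nonneg] with x h₁ h₂
    rw [Real.norm_of_nonneg (hw_nonneg x), Real.norm_of_nonneg h₂, inv_mul_eq_div,
      le_div_iff₀' hc]
    exact h₁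
  have hint : ∀ u v : Lp ℝ 2 μ, Integrable (fun x => u x * v x) μ := fun u v =>
    (Lp.memLp u).integrable_mul (Lp.memLp v)
  have hinner : ∀ u v : Lp ℝ 2 μ, ∫ x, u x * v x ∂μ = ⟪u, v⟫ := fun u v => by
    rw [L2.inner_def]
    exact integral_congr_ae (.of_forall fun x => mul_comm _ _)
  have hlow : ∫ x, |(S t u₀) x| * w x ∂μ ≤ ∫ x, c⁻¹ * ((S t |u₀|) x * (φ 0) x) ∂μ := by
    refine integral_mono_ae ((Lp.memLp _).abs.integrable_mul hw)
      ((hint _ _).const_mul _) ?_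
    filter_upwards [hdom, hcw] with x h₁ h₂
    have hS0 : 0 ≤ (S t |u₀|) x := (abs_nonneg _).trans h₁
    calc |(S t u₀) x| * w x ≤ (S t |u₀|) x * w x := by gcongr; exact hw_nonneg x
      _ = c⁻¹ * ((S t |u₀|) x * (c * w x)) := by field_simp
      _ ≤ _ := by gcongr
  have hupp : ∫ x, |u₀| x * (φ 0) x ∂μ ≤ ∫ x, C * (|u₀ x| * w x) ∂μ := by
    refine integral_mono_ae (hint _ _)
      (((Lp.memLp u₀).abs.integrable_mul hw).const_mul _) ?_
    filter_upwards [Lp.coeFn_abs u₀, hCw] with x h₁ h₂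
    calc |u₀| x * (φ 0) x = |u₀ x| * (φ 0) x := by rw [h₁]
      _ ≤ |u₀ x| * (C * w x) := by gcongr
      _ = _ := by ring
  rw [integral_const_mul] at hlow hupp
  rw [hinner, hS t |u₀|, φ.inner_tsum_mul_inner_smul ha, ← hinner] at hlow
  calc ∫ x, |(S t u₀) x| * w x ∂μ
      ≤ c⁻¹ * (Real.exp (-(lam 0) * t) * ∫ x, |u₀| x * (φ 0) x ∂μ) := hlow
    _ ≤ c⁻¹ * (Real.exp (-(lam 0) * t) * (C * ∫ x, |u₀ x| * w x ∂μ)) := by gcongr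
    _ = _ := by ring
end

section
/- Large-time two-sided asymptotics of the heat kernel series: for every ε ∈ (0,1) there exists T > 0 such that for all t ≥ T and all x, y ∈ Ω, (1−ε) e^{−λ_1 t} φ_1(x) φ_1(y) ≤ 𝕊(t,x,y) ≤ (1+ε) e^{−λ_1 t} φ_1(x) φ_1(y). -/
/-- Bounds `C₀ * a ^ w * p` and `C₀ * a ^ w * q` on two factors give the bound
`C₀ ^ 2 * a ^ (2 * w) * (p * q)` on their product. -/
lemma abs_mul_le_of_abs_le_rpow {C₀ a w u v p q : ℝ} (ha : 0 < a)
    (hu : |u| ≤ C₀ * a ^ w * p) (hv : |v| ≤ C₀ * a ^ w * q) :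
    |u * v| ≤ C₀ ^ 2 * a ^ (2 * w) * (p * q) := by
  have hrpow : a ^ (2 * w) = a ^ w * a ^ w := by rw [two_mul, Real.rpow_add ha]
  calc |u * v| = |u| * |v| := abs_mul u v
    _ ≤ (C₀ * a ^ w * p) * (C₀ * a ^ w * q) :=
      mul_le_mul hu hv (abs_nonneg v) ((abs_nonneg u).trans hu)
    _ = C₀ ^ 2 * a ^ (2 * w) * (p * q) := by rw [hrpow]; ring

/-- For `t ≥ 1` and `b ≤ a`, the decay rate `b` can be split off `exp (-a * t)`. -/
lemma exp_neg_mul_le_of_le {a b t : ℝ} (hba : b ≤ a) (ht : 1 ≤ t) :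
    Real.exp (-a * t) ≤ Real.exp (-b * (t - 1)) * Real.exp (-a * 1) := by
  rw [← Real.exp_add, Real.exp_le_exp]
  nlinarith [mul_nonneg (sub_nonneg.2 hba) (sub_nonneg.2 ht)]

/-- A faster decaying exponential is eventually small relative to a slower one. -/
lemma eventually_mul_exp_le {a b ε : ℝ} (hab : a < b) (hε : 0 < ε) (K : ℝ) :
    ∀ᶠ t in Filter.atTop, K * Real.exp (-b * (t - 1)) ≤ ε * Real.exp (-a * t) := by
  have hlim : Filter.Tendsto (fun t : ℝ => K * Real.exp b * Real.exp (-((b - a) * t)))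
      Filter.atTop (nhds 0) := by
    have h := (Real.tendsto_exp_neg_atTop_nhds_zero.comp
      (Filter.tendsto_id.const_mul_atTop (sub_pos.2 hab))).const_mul (K * Real.exp b)
    simpa using h
  filter_upwards [hlim.eventually_le_const hε] with t ht
  calc K * Real.exp (-b * (t - 1))
      = K * Real.exp b * Real.exp (-((b - a) * t)) * Real.exp (-a * t) := by
        rw [mul_assoc, mul_assoc, ← Real.exp_add, ← Real.exp_add]
        ring_nf
    _ ≤ ε * Real.exp (-a * t) := by gcongr

/-- **Large-time two-sided asymptotics of the heat kernel series.**
With `𝕊(t,x,y) = ∑ e^{-λ_m t} φ_m(x) φ_m(y)`, for every `ε ∈ (0,1)` there is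
`T > 0` such that for all `t ≥ T` and all `x, y ∈ Ω`,
`(1-ε) e^{-λ₁ t} φ₁(x) φ₁(y) ≤ 𝕊(t,x,y) ≤ (1+ε) e^{-λ₁ t} φ₁(x) φ₁(y)`. -/
theorem heat_kernel_large_time_asymptotics
    {Ω : Type*} (lam : ℕ → ℝ) (hmono : Monotone lam)
    (hpos : 0 < lam 0) (hgap : lam 0 < lam 1)
    (φ : ℕ → Ω → ℝ) (hφ1pos : ∀ x, 0 < φ 0 x)
    (C₀ w : ℝ) (hC₀ : 0 < C₀) (hw : 0 < w)
    (hbound : ∀ m : ℕ, ∀ x : Ω, |φ m x| ≤ C₀ * lam m ^ w * φ 0 x)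
    (hsum : ∀ t : ℝ, 0 < t → Summable fun m => Real.exp (-(lam m) * t) * lam m ^ (2 * w))
    (ε : ℝ) (hε0 : 0 < ε) (hε1 : ε < 1) :
    ∃ T : ℝ, 0 < T ∧ ∀ t : ℝ, T ≤ t → ∀ x y : Ω,
      (1 - ε) * Real.exp (-(lam 0) * t) * φ 0 x * φ 0 y ≤
        (∑' m, Real.exp (-(lam m) * t) * φ m x * φ m y) ∧
      (∑' m, Real.exp (-(lam m) * t) * φ m x * φ m y) ≤
        (1 + ε) * Real.exp (-(lam 0) * t) * φ 0 x * φ 0 y := by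
  have hlam : ∀ m, 0 < lam m := fun m => hpos.trans_le (hmono (Nat.zero_le m))
  set g : ℕ → ℝ := fun m => Real.exp (-(lam m) * 1) * lam m ^ (2 * w) with hg
  have hgs : Summable fun m => g (m + 1) := (summable_nat_add_iff 1).2 (hsum 1 one_pos)
  obtain ⟨T, hT⟩ := Filter.eventually_atTop.1
    (eventually_mul_exp_le hgap hε0 (C₀ ^ 2 * ∑' m, g (m + 1)))
  refine ⟨max T 1, lt_max_of_lt_right one_pos, fun t ht x y => ?_⟩
  have ht1 : 1 ≤ t := (le_max_right _ _).trans ht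
  have hxy : 0 < φ 0 x * φ 0 y := mul_pos (hφ1pos x) (hφ1pos y)
  set f : ℕ → ℝ := fun m => Real.exp (-(lam m) * t) * φ m x * φ m y with hf
  set c : ℝ := C₀ ^ 2 * Real.exp (-(lam 1) * (t - 1)) * (φ 0 x * φ 0 y) with hc
  have hterm : ∀ m, ‖f (m + 1)‖ ≤ c * g (m + 1) := fun m => by
    calc ‖f (m + 1)‖
        = Real.exp (-(lam (m + 1)) * t) * |φ (m + 1) x * φ (m + 1) y| := by
          simp only [hf, Real.norm_eq_abs, mul_assoc, abs_mul, Real.abs_exp]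
      _ ≤ (Real.exp (-(lam 1) * (t - 1)) * Real.exp (-(lam (m + 1)) * 1)) *
            (C₀ ^ 2 * lam (m + 1) ^ (2 * w) * (φ 0 x * φ 0 y)) := by
          gcongr
          · exact exp_neg_mul_le_of_le (hmono (Nat.le_add_left 1 m)) ht1
          · exact abs_mul_le_of_abs_le_rpow (hlam _) (hbound _ x) (hbound _ y)
      _ = c * g (m + 1) := by rw [hc, hg]; ring
  have hfs : Summable f :=
    (summable_nat_add_iff 1).1 (Summable.of_norm_bounded (hgs.mul_left c) hterm)
  have htail : |∑' m, f (m + 1)| ≤ ε * Real.exp (-(lam 0) * t) * (φ 0 x * φ 0 y) := by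
    calc |∑' m, f (m + 1)| ≤ c * ∑' m, g (m + 1) :=
          tsum_of_norm_bounded (hgs.hasSum.mul_left c) hterm
      _ = (C₀ ^ 2 * ∑' m, g (m + 1)) * Real.exp (-(lam 1) * (t - 1)) *
            (φ 0 x * φ 0 y) := by rw [hc]; ring
      _ ≤ ε * Real.exp (-(lam 0) * t) * (φ 0 x * φ 0 y) := by
          gcongr ?_ * (φ 0 x * φ 0 y)
          exact hT t ((le_max_left _ _).trans ht)
  have hf0 : f 0 = Real.exp (-(lam 0) * t) * (φ 0 x * φ 0 y) := mul_assoc _ _ _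
  rw [hfs.tsum_eq_zero_add, hf0]
  obtain ⟨hlower, hupper⟩ := abs_le.1 htail
  constructor <;> linarith
end

section
/- Hopf-type bound for large times: let in addition (Ω, μ) be a measure space with each φ_m measurable, and let u₀ : Ω → [0,∞) be measurable with ∫_Ω u₀ φ_1 dμ < ∞. Then there exist T > 0 and C ≥ 1 such that for all t ≥ T and all x ∈ Ω, C^{−1} e^{−λ_1 t} φ_1(x) ∫_Ω u₀ φ_1 dμ ≤ ∫_Ω 𝕊(t,x,y) u₀(y) dμ(y) ≤ C e^{−λ_1 t} φ_1(x) ∫_Ω u₀ φ_1 dμ. -/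
open MeasureTheory

/-- For large times the spectral tail is dominated by half of the ground-state factor. -/
lemma exists_time_tail_le_half_exp {lam0 lam1 : ℝ} (hgap : lam0 < lam1) (K : ℝ) :
    ∃ T : ℝ, 1 ≤ T ∧ ∀ t : ℝ, T ≤ t →
      Real.exp (-lam1 * (t - 1)) * K ≤ Real.exp (-lam0 * t) / 2 := by
  have hlim : Filter.Tendsto (fun t : ℝ => Real.exp (-((lam1 - lam0) * t)) * (Real.exp lam1 * K))
      Filter.atTop (nhds (0 * (Real.exp lam1 * K))) :=
    (Real.tendsto_exp_neg_atTop_nhds_zero.comp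
      (Filter.tendsto_id.const_mul_atTop (sub_pos.2 hgap))).mul_const _
  rw [zero_mul] at hlim
  obtain ⟨T, hT⟩ := Filter.eventually_atTop.1
    (hlim.eventually (ge_mem_nhds (show (0 : ℝ) < 1 / 2 by norm_num)))
  refine ⟨max 1 T, le_max_left _ _, fun t ht => ?_⟩
  have h := hT t ((le_max_right _ _).trans ht)
  have hexp : Real.exp (-lam1 * (t - 1)) =
      Real.exp (-lam0 * t) * (Real.exp (-((lam1 - lam0) * t)) * Real.exp lam1) := by
    rw [← Real.exp_add, ← Real.exp_add]
    ring_nf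
  rw [hexp]
  calc _ = Real.exp (-lam0 * t) * (Real.exp (-((lam1 - lam0) * t)) * (Real.exp lam1 * K)) := by
        ring
    _ ≤ Real.exp (-lam0 * t) * (1 / 2) := mul_le_mul_of_nonneg_left h (Real.exp_pos _).le
    _ = _ := by ring

section SpectralSeries

variable {Ω : Type*} {lam : ℕ → ℝ} {φ : ℕ → Ω → ℝ} {C₀ w : ℝ}

/-- Each term of the spectral series is controlled by the ground state. -/
lemma abs_spectral_term_le (hlam : ∀ m, 0 < lam m)
    (hbound : ∀ m x, |φ m x| ≤ C₀ * lam m ^ w * φ 0 x) (t : ℝ) (x y : Ω) (m : ℕ) :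
    |Real.exp (-(lam m) * t) * φ m x * φ m y| ≤
      C₀ ^ 2 * (φ 0 x * φ 0 y) * (Real.exp (-(lam m) * t) * lam m ^ (2 * w)) := by
  have hpow : lam m ^ (2 * w) = lam m ^ w * lam m ^ w := by
    rw [two_mul, Real.rpow_add (hlam m)]
  rw [abs_mul, abs_mul, Real.abs_exp, hpow, mul_assoc]
  calc _ ≤ Real.exp (-(lam m) * t) *
        ((C₀ * lam m ^ w * φ 0 x) * (C₀ * lam m ^ w * φ 0 y)) :=
        mul_le_mul_of_nonneg_left
          (mul_le_mul (hbound m x) (hbound m y) (abs_nonneg _)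
            ((abs_nonneg _).trans (hbound m x))) (Real.exp_pos _).le
    _ = _ := by ring

lemma summable_spectral_term (hlam : ∀ m, 0 < lam m)
    (hbound : ∀ m x, |φ m x| ≤ C₀ * lam m ^ w * φ 0 x) {t : ℝ}
    (hsum : Summable fun m => Real.exp (-(lam m) * t) * lam m ^ (2 * w)) (x y : Ω) :
    Summable fun m => Real.exp (-(lam m) * t) * φ m x * φ m y :=
  (hsum.mul_left (C₀ ^ 2 * (φ 0 x * φ 0 y))).of_norm_bounded
    (abs_spectral_term_le hlam hbound t x y)

/-- The spectral series differs from its first term by at most a multiple of the ground state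
which decays like `exp (-(lam 1) * t)`. -/
lemma abs_spectral_series_sub_le (hmono : Monotone lam) (hpos : 0 < lam 0)
    (hφ1pos : ∀ x, 0 < φ 0 x) (hbound : ∀ m x, |φ m x| ≤ C₀ * lam m ^ w * φ 0 x)
    (hsum : ∀ t : ℝ, 0 < t → Summable fun m => Real.exp (-(lam m) * t) * lam m ^ (2 * w))
    {t : ℝ} (ht : 1 ≤ t) (x y : Ω) :
    |(∑' m, Real.exp (-(lam m) * t) * φ m x * φ m y) -
        Real.exp (-(lam 0) * t) * φ 0 x * φ 0 y| ≤
      φ 0 x * φ 0 y * (Real.exp (-(lam 1) * (t - 1)) *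
        (C₀ ^ 2 * ∑' m, Real.exp (-(lam (m + 1)) * 1) * lam (m + 1) ^ (2 * w))) := by
  have hlam : ∀ m, 0 < lam m := fun m => hpos.trans_le (hmono m.zero_le)
  rw [(summable_spectral_term hlam hbound (hsum t (by linarith)) x y).tsum_eq_zero_add,
    add_sub_cancel_left]
  have hmajorant := ((((summable_nat_add_iff 1).2 (hsum 1 one_pos)).hasSum.mul_left
    (C₀ ^ 2)).mul_left (Real.exp (-(lam 1) * (t - 1)))).mul_left (φ 0 x * φ 0 y)
  rw [← Real.norm_eq_abs]
  refine tsum_of_norm_bounded hmajorant fun m => ?_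
  refine (abs_spectral_term_le hlam hbound t x y (m + 1)).trans ?_
  have hexp : Real.exp (-(lam (m + 1)) * t) ≤
      Real.exp (-(lam 1) * (t - 1)) * Real.exp (-(lam (m + 1)) * 1) := by
    rw [← Real.exp_add]
    refine Real.exp_le_exp.2 ?_
    have hle : lam 1 ≤ lam (m + 1) := hmono (by omega)
    nlinarith
  have hcoef : 0 ≤ C₀ ^ 2 * (φ 0 x * φ 0 y) * lam (m + 1) ^ (2 * w) :=
    mul_nonneg (mul_nonneg (sq_nonneg _) (mul_pos (hφ1pos x) (hφ1pos y)).le)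
      (Real.rpow_nonneg (hlam _).le _)
  calc _ = C₀ ^ 2 * (φ 0 x * φ 0 y) * lam (m + 1) ^ (2 * w) * Real.exp (-(lam (m + 1)) * t) := by
        ring
    _ ≤ _ := mul_le_mul_of_nonneg_left hexp hcoef
    _ = _ := by ring

end SpectralSeries

/-- **Hopf-type bound for large times.**
With `𝕊(t,x,y) = ∑ e^{-λ_m t} φ_m(x) φ_m(y)` and `u₀ ≥ 0` measurable with
`∫ u₀ φ₁ dμ < ∞`, there exist `T > 0` and `C ≥ 1` such that for all `t ≥ T` and `x ∈ Ω`,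
`C⁻¹ e^{-λ₁ t} φ₁(x) ∫ u₀ φ₁ dμ ≤ ∫ 𝕊(t,x,y) u₀(y) dμ(y) ≤ C e^{-λ₁ t} φ₁(x) ∫ u₀ φ₁ dμ`. -/
theorem heat_kernel_hopf_bound_large_time
    {Ω : Type*} [MeasurableSpace Ω] (μ : Measure Ω)
    (lam : ℕ → ℝ) (hmono : Monotone lam)
    (hpos : 0 < lam 0) (hgap : lam 0 < lam 1)
    (φ : ℕ → Ω → ℝ) (hφ_meas : ∀ m, Measurable (φ m)) (hφ1pos : ∀ x, 0 < φ 0 x)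
    (C₀ w : ℝ) (hC₀ : 0 < C₀) (hw : 0 < w)
    (hbound : ∀ m : ℕ, ∀ x : Ω, |φ m x| ≤ C₀ * lam m ^ w * φ 0 x)
    (hsum : ∀ t : ℝ, 0 < t → Summable fun m => Real.exp (-(lam m) * t) * lam m ^ (2 * w))
    (u₀ : Ω → ℝ) (hu₀_meas : Measurable u₀) (hu₀_nonneg : ∀ x, 0 ≤ u₀ x)
    (hu₀_int : Integrable (fun y => u₀ y * φ 0 y) μ) :
    ∃ T : ℝ, 0 < T ∧ ∃ C : ℝ, 1 ≤ C ∧ ∀ t : ℝ, T ≤ t → ∀ x : Ω,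
      C⁻¹ * Real.exp (-(lam 0) * t) * φ 0 x * (∫ y, u₀ y * φ 0 y ∂μ) ≤
        (∫ y, (∑' m, Real.exp (-(lam m) * t) * φ m x * φ m y) * u₀ y ∂μ) ∧
      (∫ y, (∑' m, Real.exp (-(lam m) * t) * φ m x * φ m y) * u₀ y ∂μ) ≤
        C * Real.exp (-(lam 0) * t) * φ 0 x * (∫ y, u₀ y * φ 0 y ∂μ) := by
  have hlam : ∀ m, 0 < lam m := fun m => hpos.trans_le (hmono m.zero_le)
  obtain ⟨T, hT1, hT⟩ := exists_time_tail_le_half_exp hgap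
    (C₀ ^ 2 * ∑' m, Real.exp (-(lam (m + 1)) * 1) * lam (m + 1) ^ (2 * w))
  refine ⟨T, by linarith, 2, by norm_num, fun t ht x => ?_⟩
  set S : Ω → ℝ := fun y => ∑' m, Real.exp (-(lam m) * t) * φ m x * φ m y
  set A : ℝ := Real.exp (-(lam 0) * t) * φ 0 x with hA
  have hA0 : 0 < A := mul_pos (Real.exp_pos _) (hφ1pos x)
  have hS_meas : Measurable S :=
    measurable_of_tendsto_metrizable
      (f := fun n y => ∑ m ∈ Finset.range n, Real.exp (-(lam m) * t) * φ m x * φ m y)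
      (fun n => Finset.measurable_fun_sum (Finset.range n) fun m _ => (hφ_meas m).const_mul _)
      (tendsto_pi_nhds.2 fun y =>
        (summable_spectral_term hlam hbound
          (hsum t (by linarith)) x y).hasSum.tendsto_sum_nat)
  have hclose : ∀ y, |S y - A * φ 0 y| ≤ A * φ 0 y / 2 := fun y => by
    refine (abs_spectral_series_sub_le hmono hpos hφ1pos hbound hsum (hT1.trans ht) x y).trans ?_
    refine (mul_le_mul_of_nonneg_left (hT t ht)
      (mul_pos (hφ1pos x) (hφ1pos y)).le).trans_eq ?_
    rw [hA]
    ring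
  have hlower : ∀ y, 2⁻¹ * A * (u₀ y * φ 0 y) ≤ S y * u₀ y := fun y => by
    have h : A * φ 0 y / 2 ≤ S y := by linarith [(abs_le.1 (hclose y)).1]
    linarith [mul_le_mul_of_nonneg_right h (hu₀_nonneg y)]
  have hupper : ∀ y, S y * u₀ y ≤ 2 * A * (u₀ y * φ 0 y) := fun y => by
    have h : S y ≤ 2 * (A * φ 0 y) := by
      linarith [(abs_le.1 (hclose y)).2, mul_pos hA0 (hφ1pos y)]
    linarith [mul_le_mul_of_nonneg_right h (hu₀_nonneg y)]
  have hint : Integrable (fun y => S y * u₀ y) μ := by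
    refine (hu₀_int.const_mul (2 * A)).mono' (hS_meas.mul hu₀_meas).aestronglyMeasurable
      (Filter.Eventually.of_forall fun y => ?_)
    have h0 : 0 ≤ 2⁻¹ * A * (u₀ y * φ 0 y) :=
      mul_nonneg (by positivity) (mul_nonneg (hu₀_nonneg y) (hφ1pos y).le)
    rw [Real.norm_of_nonneg (h0.trans (hlower y))]
    exact hupper y
  constructor
  · rw [mul_assoc 2⁻¹, ← hA, ← integral_const_mul]
    exact integral_mono (hu₀_int.const_mul _) hint hlower
  · rw [mul_assoc 2, ← hA, ← integral_const_mul]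
    exact integral_mono hint (hu₀_int.const_mul _) hupper
end

section
/- Weak-dual identity for the Duhamel solution with L² data: let T > 0 and let f, φ : [0,T] → H be Bochner integrable. For u₀ ∈ H define u(t) = S(t)u₀ + ∫_0^t S(t−σ) f(σ) dσ and v(t) = ∫_0^t S(t−σ) φ(σ) dσ for t ∈ [0,T]. Then ∫_0^T ⟨u(t), φ(T−t)⟩ dt = ⟨u₀, v(T)⟩ + ∫_0^T ⟨f(t), v(T−t)⟩ dt. -/
open scoped RealInnerProductSpace
open MeasureTheory

section HeatSemigroup

variable {H : Type*} [NormedAddCommGroup H] [InnerProductSpace ℝ H]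

/-- The series `∑ e^{-λ_k t} ⟪x, φ_k⟫ φ_k`. -/
noncomputable def heatSemigroup (φ : HilbertBasis ℕ ℝ H) (lam : ℕ → ℝ) (t : ℝ) (x : H) : H :=
  ∑' k, (Real.exp (-(lam k) * t) * ⟪x, φ k⟫) • φ k

variable {φ : HilbertBasis ℕ ℝ H} {lam : ℕ → ℝ}

/-- A diagonal multiplier with coefficients bounded by `1` is a contraction. -/
theorem HilbertBasis.exists_hasSum_mul_inner_smul (φ : HilbertBasis ℕ ℝ H) {c : ℕ → ℝ}
    (hc : ∀ k, |c k| ≤ 1) (x : H) :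
    ∃ y, HasSum (fun k => (c k * ⟪x, φ k⟫) • φ k) y ∧ ‖y‖ ≤ ‖x‖ := by
  have hle : ∀ k, ‖c k * ⟪x, φ k⟫‖ ≤ ‖φ.repr x k‖ := fun k => by
    rw [φ.repr_apply_apply, real_inner_comm x, norm_mul, Real.norm_eq_abs (c k)]
    exact mul_le_of_le_one_left (norm_nonneg _) (hc k)
  let w : lp (fun _ : ℕ => ℝ) 2 :=
    ⟨fun k => c k * ⟪x, φ k⟫, (lp.memℓp (φ.repr x)).mono' hle⟩
  refine ⟨φ.repr.symm w, φ.hasSum_repr_symm w, ?_⟩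
  rw [LinearIsometryEquiv.norm_map, ← φ.repr.norm_map x]
  exact lp.norm_mono (by norm_num) hle

theorem abs_exp_neg_mul_le_one {a t : ℝ} (ha : 0 ≤ a) (ht : 0 ≤ t) :
    |Real.exp (-a * t)| ≤ 1 := by
  rw [Real.abs_exp, Real.exp_le_one_iff]
  nlinarith [mul_nonneg ha ht]

theorem hasSum_heatSemigroup (hlam : ∀ k, 0 ≤ lam k) {t : ℝ} (ht : 0 ≤ t) (x : H) :
    HasSum (fun k => (Real.exp (-(lam k) * t) * ⟪x, φ k⟫) • φ k) (heatSemigroup φ lam t x) := by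
  obtain ⟨y, hy, -⟩ := φ.exists_hasSum_mul_inner_smul
    (fun k => abs_exp_neg_mul_le_one (hlam k) ht) x
  exact hy.summable.hasSum

theorem norm_heatSemigroup_le (hlam : ∀ k, 0 ≤ lam k) {t : ℝ} (ht : 0 ≤ t) (x : H) :
    ‖heatSemigroup φ lam t x‖ ≤ ‖x‖ := by
  obtain ⟨y, hy, hle⟩ := φ.exists_hasSum_mul_inner_smul
    (fun k => abs_exp_neg_mul_le_one (hlam k) ht) x
  rwa [heatSemigroup, hy.tsum_eq]

theorem inner_heatSemigroup_left (hlam : ∀ k, 0 ≤ lam k) {t : ℝ} (ht : 0 ≤ t) (x y : H) :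
    ⟪heatSemigroup φ lam t x, y⟫ = ⟪x, heatSemigroup φ lam t y⟫ := by
  have hx := (hasSum_heatSemigroup (φ := φ) hlam ht x).mapL (innerSL ℝ y)
  have hy := (hasSum_heatSemigroup (φ := φ) hlam ht y).mapL (innerSL ℝ x)
  rw [real_inner_comm]
  refine hx.unique (hy.congr_fun fun k => ?_)
  simp only [innerSL_apply_apply, real_inner_smul_right]
  ring

theorem MeasureTheory.AEStronglyMeasurable.heatSemigroup_comp {α : Type*} [MeasurableSpace α] {μ : Measure α}
    (hlam : ∀ k, 0 ≤ lam k) {r : α → ℝ} {h : α → H} (hr : Measurable r)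
    (hr0 : ∀ᵐ a ∂μ, 0 ≤ r a) (hh : AEStronglyMeasurable h μ) :
    AEStronglyMeasurable (fun a => heatSemigroup φ lam (r a) (h a)) μ := by
  refine aestronglyMeasurable_of_tendsto_ae Filter.atTop
    (f := fun n a => ∑ k ∈ Finset.range n, (Real.exp (-(lam k) * r a) * ⟪h a, φ k⟫) • φ k)
    (fun n => ?_) ?_
  · refine Finset.aestronglyMeasurable_fun_sum _ fun k _ => ?_
    refine AEStronglyMeasurable.smul_const (AEStronglyMeasurable.mul ?_ ?_) _
    · exact (by fun_prop : Measurable fun a => Real.exp (-(lam k) * r a)).aestronglyMeasurable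
    · exact hh.inner aestronglyMeasurable_const
  · filter_upwards [hr0] with a ha
    exact (hasSum_heatSemigroup hlam ha _).tendsto_sum_nat

theorem MeasureTheory.Integrable.heatSemigroup_comp {α : Type*} [MeasurableSpace α] {μ : Measure α}
    (hlam : ∀ k, 0 ≤ lam k) {r : α → ℝ} {h : α → H} (hr : Measurable r)
    (hr0 : ∀ᵐ a ∂μ, 0 ≤ r a) (hh : Integrable h μ) :
    Integrable (fun a => heatSemigroup φ lam (r a) (h a)) μ := by
  refine hh.mono (AEStronglyMeasurable.heatSemigroup_comp hlam hr hr0 hh.aestronglyMeasurable) ?_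
  filter_upwards [hr0] with a ha using norm_heatSemigroup_le hlam ha _

/-- The pairing kernel of two sources is integrable on the triangle `σ ≤ t`. -/
theorem integrable_indicator_inner_heatSemigroup (hlam : ∀ k, 0 ≤ lam k) {μ : Measure ℝ}
    [SFinite μ] {f g : ℝ → H} (hf : Integrable f μ) (hg : Integrable g μ) :
    Integrable ({p : ℝ × ℝ | p.2 ≤ p.1}.indicator
      fun p => ⟪heatSemigroup φ lam (p.1 - p.2) (f p.2), g p.1⟫) (μ.prod μ) := by
  have hmeas : MeasurableSet {p : ℝ × ℝ | p.2 ≤ p.1} :=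
    measurableSet_le measurable_snd measurable_fst
  have hpos : ∀ᵐ p ∂(μ.prod μ).restrict {p : ℝ × ℝ | p.2 ≤ p.1}, 0 ≤ p.1 - p.2 := by
    filter_upwards [ae_restrict_mem hmeas] with p hp using sub_nonneg.2 hp
  rw [integrable_indicator_iff hmeas]
  refine ((hg.norm.mul_prod hf.norm).integrableOn (s := {p : ℝ × ℝ | p.2 ≤ p.1})).mono' ?_ ?_
  · refine (AEStronglyMeasurable.heatSemigroup_comp hlam (by fun_prop) hpos
      hf.aestronglyMeasurable.comp_snd.restrict).inner
      hg.aestronglyMeasurable.comp_fst.restrict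
  · filter_upwards [hpos] with p hp
    rw [mul_comm]
    exact (norm_inner_le_norm _ _).trans
      (mul_le_mul_of_nonneg_right (norm_heatSemigroup_le hlam hp _) (norm_nonneg _))

variable [CompleteSpace H]

/-- Pairing the free evolution of `u₀` with a reversed source. -/
theorem integral_inner_heatSemigroup (hlam : ∀ k, 0 ≤ lam k) {T : ℝ} (hT : 0 ≤ T) {ψ : ℝ → H}
    (hψ : IntervalIntegrable ψ volume 0 T) (u₀ : H) :
    ∫ t in (0:ℝ)..T, ⟪heatSemigroup φ lam t u₀, ψ (T - t)⟫ =
      ⟪u₀, ∫ s in (0:ℝ)..T, heatSemigroup φ lam (T - s) (ψ s)⟫ := by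
  have hψ' : IntervalIntegrable (fun t => ψ (T - t)) volume 0 T := by
    simpa using (hψ.comp_sub_left T).symm
  have hsub : ∫ s in (0:ℝ)..T, heatSemigroup φ lam (T - s) (ψ s) =
      ∫ t in (0:ℝ)..T, heatSemigroup φ lam t (ψ (T - t)) := by
    simpa using (intervalIntegral.integral_comp_sub_left (a := 0) (b := T)
      (fun s => heatSemigroup φ lam (T - s) (ψ s)) T).symm
  have hpos : ∀ᵐ t ∂volume.restrict (Set.Ioc 0 T), (0:ℝ) ≤ t := by
    filter_upwards [ae_restrict_mem measurableSet_Ioc] with t ht using ht.1.le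
  rw [hsub, intervalIntegral.integral_of_le hT, intervalIntegral.integral_of_le hT,
    ← integral_inner (Integrable.heatSemigroup_comp hlam measurable_id' hpos
      ((intervalIntegrable_iff_integrableOn_Ioc_of_le hT).1 hψ'))]
  refine setIntegral_congr_fun measurableSet_Ioc fun t ht => ?_
  exact inner_heatSemigroup_left hlam ht.1.le _ _

/-- The inner integral of the pairing kernel over `σ` is the pairing with the Duhamel term. -/
theorem integral_indicator_inner_left (hlam : ∀ k, 0 ≤ lam k) {T t : ℝ} {f : ℝ → H}
    (hf : IntegrableOn f (Set.Ioc 0 T)) (ht : t ∈ Set.Ioc 0 T) (y : H) :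
    ∫ σ in Set.Ioc 0 T, {p : ℝ × ℝ | p.2 ≤ p.1}.indicator
      (fun p => ⟪heatSemigroup φ lam (p.1 - p.2) (f p.2), y⟫) (t, σ) =
      ⟪∫ σ in (0:ℝ)..t, heatSemigroup φ lam (t - σ) (f σ), y⟫ := by
  have hpos : ∀ᵐ σ ∂volume.restrict (Set.Ioc 0 t), 0 ≤ t - σ := by
    filter_upwards [ae_restrict_mem measurableSet_Ioc] with σ hσ using sub_nonneg.2 hσ.2
  have hset : Set.Ioc 0 T ∩ Set.Iic t = Set.Ioc 0 t := by
    rw [Set.Ioc_inter_Iic, min_eq_right ht.2]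
  have hind : ∀ σ, {p : ℝ × ℝ | p.2 ≤ p.1}.indicator
      (fun p => ⟪heatSemigroup φ lam (p.1 - p.2) (f p.2), y⟫) (t, σ) =
      (Set.Iic t).indicator (fun σ => ⟪y, heatSemigroup φ lam (t - σ) (f σ)⟫) σ := fun σ => by
    simp [Set.indicator_apply, real_inner_comm]
  simp_rw [hind]
  rw [setIntegral_indicator measurableSet_Iic, hset, intervalIntegral.integral_of_le ht.1.le,
    real_inner_comm]
  exact integral_inner (Integrable.heatSemigroup_comp hlam (by fun_prop) hpos
    (hf.mono_set (Set.Ioc_subset_Ioc_right ht.2))) y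

/-- The inner integral of the pairing kernel over `t` is the pairing with the dual Duhamel term. -/
theorem integral_indicator_inner_right (hlam : ∀ k, 0 ≤ lam k) {T σ : ℝ} {ψ : ℝ → H}
    (hψ : IntegrableOn (fun t => ψ (T - t)) (Set.Ioc 0 T)) (hσ : σ ∈ Set.Ioc 0 T) (x : H) :
    ∫ t in Set.Ioc 0 T, {p : ℝ × ℝ | p.2 ≤ p.1}.indicator
      (fun p => ⟪heatSemigroup φ lam (p.1 - p.2) x, ψ (T - p.1)⟫) (t, σ) =
      ⟪x, ∫ s in (0:ℝ)..(T - σ), heatSemigroup φ lam (T - σ - s) (ψ s)⟫ := by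
  have hpos : ∀ᵐ t ∂volume.restrict (Set.Icc σ T), 0 ≤ t - σ := by
    filter_upwards [ae_restrict_mem measurableSet_Icc] with t ht using sub_nonneg.2 ht.1
  have hset : Set.Ioc 0 T ∩ Set.Ici σ = Set.Icc σ T := by
    ext t
    simp only [Set.mem_inter_iff, Set.mem_Ioc, Set.mem_Ici, Set.mem_Icc]
    exact ⟨fun h => ⟨h.2, h.1.2⟩, fun h => ⟨⟨hσ.1.trans_le h.1, h.2⟩, h.1⟩⟩
  have hind : ∀ t, {p : ℝ × ℝ | p.2 ≤ p.1}.indicator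
      (fun p => ⟪heatSemigroup φ lam (p.1 - p.2) x, ψ (T - p.1)⟫) (t, σ) =
      (Set.Ici σ).indicator (fun t => ⟪x, heatSemigroup φ lam (t - σ) (ψ (T - t))⟫) t :=
    fun t => by
      by_cases h : σ ≤ t
      · simpa [Set.indicator_apply, h] using inner_heatSemigroup_left hlam (sub_nonneg.2 h) _ _
      · simp [h]
  have hsub : ∫ s in (0:ℝ)..(T - σ), heatSemigroup φ lam (T - σ - s) (ψ s) =
      ∫ t in σ..T, heatSemigroup φ lam (t - σ) (ψ (T - t)) := by
    have := intervalIntegral.integral_comp_sub_left (a := σ) (b := T)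
      (fun s => heatSemigroup φ lam (T - σ - s) (ψ s)) T
    rw [sub_self] at this
    rw [← this]
    refine intervalIntegral.integral_congr fun t _ => ?_
    simp only [show T - σ - (T - t) = t - σ by ring]
  simp_rw [hind]
  rw [setIntegral_indicator measurableSet_Ici, hset, hsub,
    intervalIntegral.integral_of_le hσ.2, ← integral_Icc_eq_integral_Ioc]
  exact integral_inner (Integrable.heatSemigroup_comp hlam (by fun_prop) hpos
    (hψ.mono_set fun t ht => ⟨hσ.1.trans_le ht.1, ht.2⟩)) x

end HeatSemigroup

/-- **Weak-dual identity for the Duhamel solution with L² data.**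
With `u(t) = S(t)u₀ + ∫_0^t S(t-σ) f(σ) dσ` and `v(t) = ∫_0^t S(t-σ) φtest(σ) dσ`,
one has `∫_0^T ⟪u(t), φtest(T-t)⟫ dt = ⟪u₀, v(T)⟫ + ∫_0^T ⟪f(t), v(T-t)⟫ dt`. -/
theorem duhamel_weak_dual_identity
    {H : Type*} [NormedAddCommGroup H] [InnerProductSpace ℝ H] [CompleteSpace H]
    (φ : HilbertBasis ℕ ℝ H) (lam : ℕ → ℝ)
    (hmono : Monotone lam) (hpos : 0 < lam 0)
    (S : ℝ → H → H)
    (hS : ∀ t u, S t u = ∑' k, (Real.exp (-(lam k) * t) * ⟪u, φ k⟫) • φ k)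
    (T : ℝ) (hT : 0 < T)
    (f φtest : ℝ → H)
    (hf : IntegrableOn f (Set.Icc 0 T) volume)
    (hφtest : IntegrableOn φtest (Set.Icc 0 T) volume)
    (u₀ : H) (u v : ℝ → H)
    (hu : ∀ t, u t = S t u₀ + ∫ σ in (0:ℝ)..t, S (t - σ) (f σ))
    (hv : ∀ t, v t = ∫ σ in (0:ℝ)..t, S (t - σ) (φtest σ)) :
    ∫ t in (0:ℝ)..T, ⟪u t, φtest (T - t)⟫ =
      ⟪u₀, v T⟫ + ∫ t in (0:ℝ)..T, ⟪f t, v (T - t)⟫ := by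
  obtain rfl : S = heatSemigroup φ lam := funext fun t => funext fun x => hS t x
  have hlam : ∀ k, 0 ≤ lam k := fun k => hpos.le.trans (hmono k.zero_le)
  have hfI : IntegrableOn f (Set.Ioc 0 T) := hf.mono_set Set.Ioc_subset_Icc_self
  have hψI : IntervalIntegrable φtest volume 0 T :=
    (intervalIntegrable_iff_integrableOn_Ioc_of_le hT.le).2
      (hφtest.mono_set Set.Ioc_subset_Icc_self)
  have hgI : IntegrableOn (fun t => φtest (T - t)) (Set.Ioc 0 T) := by
    rw [← intervalIntegrable_iff_integrableOn_Ioc_of_le hT.le]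
    simpa using (hψI.comp_sub_left T).symm
  have hfree : IntegrableOn (fun t => ⟪heatSemigroup φ lam t u₀, φtest (T - t)⟫)
      (Set.Ioc 0 T) := by
    have hpos' : ∀ᵐ t ∂volume.restrict (Set.Ioc 0 T), (0:ℝ) ≤ t := by
      filter_upwards [ae_restrict_mem measurableSet_Ioc] with t ht using ht.1.le
    refine ((Integrable.heatSemigroup_comp (φ := φ) hlam measurable_id' hpos' hgI).const_inner
      u₀).congr ?_
    filter_upwards [hpos'] with t ht using (inner_heatSemigroup_left hlam ht _ _).symm
  have hker := integrable_indicator_inner_heatSemigroup (φ := φ) hlam hfI hgI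
  have hduh : ∀ t ∈ Set.Ioc 0 T, ∫ σ in Set.Ioc 0 T, {p : ℝ × ℝ | p.2 ≤ p.1}.indicator
      (fun p => ⟪heatSemigroup φ lam (p.1 - p.2) (f p.2), φtest (T - p.1)⟫) (t, σ) =
      ⟪∫ σ in (0:ℝ)..t, heatSemigroup φ lam (t - σ) (f σ), φtest (T - t)⟫ := fun t ht =>
    integral_indicator_inner_left hlam hfI ht (φtest (T - t))
  have hdual : ∀ σ ∈ Set.Ioc 0 T, ∫ t in Set.Ioc 0 T, {p : ℝ × ℝ | p.2 ≤ p.1}.indicator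
      (fun p => ⟪heatSemigroup φ lam (p.1 - p.2) (f p.2), φtest (T - p.1)⟫) (t, σ) =
      ⟪f σ, v (T - σ)⟫ := fun σ hσ => by
    rw [hv]
    exact integral_indicator_inner_right hlam hgI hσ (f σ)
  rw [hv T, ← integral_inner_heatSemigroup hlam hT.le hψI, intervalIntegral.integral_of_le hT.le,
    intervalIntegral.integral_of_le hT.le, intervalIntegral.integral_of_le hT.le,
    ← setIntegral_congr_fun measurableSet_Ioc hdual,
    ← integral_integral_swap (f := fun t σ => {p : ℝ × ℝ | p.2 ≤ p.1}.indicator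
      (fun p => ⟪heatSemigroup φ lam (p.1 - p.2) (f p.2), φtest (T - p.1)⟫) (t, σ)) hker,
    ← integral_add hfree hker.integral_prod_left]
  refine setIntegral_congr_fun measurableSet_Ioc fun t ht => ?_
  simp only [hu t, inner_add_left, hduh t ht]
end

section
/- Weighted ultracontractivity of the heat semigroup from eigenfunction growth bounds: suppose each φ_k is given by an everywhere-defined measurable representative φ_k : Ω → ℝ, and there exist a function g : Ω → [0,∞) and constants C > 0, w > 0 such that |φ_k(x)| ≤ C λ_k^w g(x) for all k ≥ 1 and x ∈ Ω. Assume moreover ∑_{k=1}^∞ e^{−λ_k t} λ_k^w < ∞ for every t > 0. Then for every u₀ ∈ L²(Ω,μ) and every t > 0, the series ∑_{k=1}^∞ e^{−λ_k t} ⟨u₀, φ_k⟩ φ_k(x) converges absolutely for every x ∈ Ω, the resulting function is a representative of S(t)u₀, and it satisfies |∑_{k=1}^∞ e^{−λ_k t} ⟨u₀, φ_k⟩ φ_k(x)| ≤ C ‖u₀‖_{L²(Ω,μ)} ( ∑_{k=1}^∞ e^{−λ_k t} λ_k^w ) g(x) for every x ∈ Ω. -/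
open scoped RealInnerProductSpace
open MeasureTheory

/-- If a series in `Lp` has sum `F` and representatives of its terms are summable at every point,
then the pointwise sum of the representatives is a representative of `F`. -/
theorem MeasureTheory.Lp.coeFn_ae_eq_tsum_of_hasSum
    {Ω E : Type*} [MeasurableSpace Ω] {μ : Measure Ω} [NormedAddCommGroup E]
    {p : ENNReal} [Fact (1 ≤ p)] {f : ℕ → Lp E p μ} {F : Lp E p μ} (hF : HasSum f F)
    {frep : ℕ → Ω → E} (hrep : ∀ k, (f k : Ω → E) =ᵐ[μ] frep k)
    (hsum : ∀ x, Summable fun k => frep k x) :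
    (F : Ω → E) =ᵐ[μ] fun x => ∑' k, frep k x := by
  obtain ⟨ns, hns, hlim⟩ :=
    (tendstoInMeasure_of_tendsto_Lp hF.tendsto_sum_nat).exists_seq_tendsto_ae
  have hpartial : ∀ n, (↑(∑ k ∈ Finset.range n, f k) : Ω → E) =ᵐ[μ]
      ∑ k ∈ Finset.range n, (f k : Ω → E) := fun n => Lp.coeFn_finsetSum _ _
  filter_upwards [hlim, ae_all_iff.2 hpartial, ae_all_iff.2 hrep] with x hx hpx hrx
  refine tendsto_nhds_unique hx (((hsum x).hasSum.tendsto_sum_nat.comp hns.tendsto_atTop).congr ?_)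
  intro n
  simp only [Function.comp_apply, hpx, Finset.sum_apply, hrx]

/-- **Weighted ultracontractivity of the heat semigroup from eigenfunction growth bounds.**
If each `φ k` has an everywhere-defined measurable representative `φrep k` with
`|φrep k x| ≤ C λ_k^w g(x)`, and `∑ e^{-λ_k t} λ_k^w < ∞` for every `t > 0`,
then for every `u₀ ∈ L²` and `t > 0` the series `∑ e^{-λ_k t} ⟪u₀, φ k⟫ φrep k x`
converges absolutely at every point, gives a representative of `S(t)u₀`, and is bounded
by `C ‖u₀‖ (∑ e^{-λ_k t} λ_k^w) g(x)`. -/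
theorem heat_semigroup_weighted_ultracontractivity
    {Ω : Type*} [MeasurableSpace Ω] (μ : Measure Ω) [IsFiniteMeasure μ]
    (φ : HilbertBasis ℕ ℝ (Lp ℝ 2 μ)) (lam : ℕ → ℝ)
    (hmono : Monotone lam) (hpos : 0 < lam 0)
    (S : ℝ → Lp ℝ 2 μ → Lp ℝ 2 μ)
    (hS : ∀ t u, S t u = ∑' k, (Real.exp (-(lam k) * t) * ⟪u, φ k⟫) • φ k)
    (φrep : ℕ → Ω → ℝ)
    (hrep_meas : ∀ k, Measurable (φrep k))
    (hrep : ∀ k, (φ k : Ω → ℝ) =ᵐ[μ] φrep k)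
    (g : Ω → ℝ) (hg_nonneg : ∀ x, 0 ≤ g x)
    (C w : ℝ) (hC : 0 < C) (hw : 0 < w)
    (hbound : ∀ k : ℕ, ∀ x : Ω, |φrep k x| ≤ C * lam k ^ w * g x)
    (hsum : ∀ t : ℝ, 0 < t → Summable fun k => Real.exp (-(lam k) * t) * lam k ^ w)
    (u₀ : Lp ℝ 2 μ) (t : ℝ) (ht : 0 < t) :
    (∀ x : Ω, Summable fun k => |Real.exp (-(lam k) * t) * ⟪u₀, φ k⟫ * φrep k x|) ∧
    ((S t u₀ : Ω → ℝ) =ᵐ[μ]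
      fun x => ∑' k, Real.exp (-(lam k) * t) * ⟪u₀, φ k⟫ * φrep k x) ∧
    (∀ x : Ω, |∑' k, Real.exp (-(lam k) * t) * ⟪u₀, φ k⟫ * φrep k x| ≤
      C * ‖u₀‖ * (∑' k, Real.exp (-(lam k) * t) * lam k ^ w) * g x) := by
  have hlam : ∀ k, lam 0 ≤ lam k := fun k => hmono (Nat.zero_le k)
  have hcoef : ∀ k, |⟪u₀, φ k⟫| ≤ ‖u₀‖ := fun k => by
    simpa [φ.orthonormal.1 k] using abs_real_inner_le_norm u₀ (φ k)
  have hterm : ∀ x k, |Real.exp (-(lam k) * t) * ⟪u₀, φ k⟫ * φrep k x| ≤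
      C * ‖u₀‖ * (Real.exp (-(lam k) * t) * lam k ^ w) * g x := fun x k => by
    rw [abs_mul, abs_mul, Real.abs_exp]
    calc Real.exp (-(lam k) * t) * |⟪u₀, φ k⟫| * |φrep k x|
        ≤ Real.exp (-(lam k) * t) * ‖u₀‖ * (C * lam k ^ w * g x) := by
          gcongr
          exacts [hcoef k, hbound k x]
      _ = _ := by ring
  have hmajor : ∀ x, Summable fun k =>
      C * ‖u₀‖ * (Real.exp (-(lam k) * t) * lam k ^ w) * g x := fun x =>
    ((hsum t ht).mul_left _).mul_right _
  have habs : ∀ x, Summable fun k => |Real.exp (-(lam k) * t) * ⟪u₀, φ k⟫ * φrep k x| :=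
    fun x => (hmajor x).of_nonneg_of_le (fun _ => abs_nonneg _) (hterm x)
  refine ⟨habs, ?_, fun x => ?_⟩
  · have hLp : Summable fun k => (Real.exp (-(lam k) * t) * ⟪u₀, φ k⟫) • φ k := by
      refine .of_norm_bounded (((hsum t ht).mul_left (‖u₀‖ / lam 0 ^ w))) fun k => ?_
      have hw0 : 0 < lam 0 ^ w := Real.rpow_pos_of_pos hpos w
      have hwk : lam 0 ^ w ≤ lam k ^ w := Real.rpow_le_rpow hpos.le (hlam k) hw.le
      rw [norm_smul, φ.orthonormal.1 k, mul_one, Real.norm_eq_abs, abs_mul, Real.abs_exp,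
        div_mul_eq_mul_div, le_div_iff₀ hw0]
      calc Real.exp (-(lam k) * t) * |⟪u₀, φ k⟫| * lam 0 ^ w
          ≤ Real.exp (-(lam k) * t) * ‖u₀‖ * lam k ^ w := by
            gcongr
            exact hcoef k
        _ = _ := by ring
    rw [hS]
    refine Lp.coeFn_ae_eq_tsum_of_hasSum hLp.hasSum (fun k => ?_) fun x => (habs x).of_abs
    filter_upwards [Lp.coeFn_smul (Real.exp (-(lam k) * t) * ⟪u₀, φ k⟫) (φ k), hrep k]
      with x hx hrx
    rw [hx, Pi.smul_apply, hrx, smul_eq_mul]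
  · rw [← tsum_mul_left, ← tsum_mul_right, ← Real.norm_eq_abs]
    exact tsum_of_norm_bounded (hmajor x).hasSum (hterm x)
end
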